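/- arXiv:1605.09614 — 3 statements merged into one kernel-verified Lean document; each statement's English description precedes it below -/
import Mathlib

section
/- Assume additionally that ν has a Lebesgue-a.e. continuous density g. If v : ℝ → [0,∞) is Borel measurable with x ≤ v(x) ≤ x + b̄ for all x ≥ 0, v(x) = 0 for x < 0, and Tv = v, then v = J, the unique fixed point of T in S. In other words, T has a unique fixed point in the larger class S′ of merely measurable functions with these bounds. In particular, if the policy improvement algorithm returns δ = α (so that T J_α = L_α J_α = J_α), then J_α = J and the stationary policy α is optimal. -/
open MeasureTheory Set Filter Topology

noncomputable section

/-- The constant `b̄ = β ∫ z⁺ ν(dz) / (1-β)`. -/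
def bbar (ν : Measure ℝ) (β : ℝ) : ℝ := β * (∫ z, max z 0 ∂ν) / (1 - β)

/-- The dynamic programming operator `T`. -/
def Tdiv (ν : Measure ℝ) (β γ : ℝ) (v : ℝ → ℝ) (x : ℝ) : ℝ :=
  if 0 ≤ x then
    sSup ((fun a => a - (β / γ) * Real.log
      ((∫ z in Ici (a - x), Real.exp (-(γ * v (x - a + z))) ∂ν)
        + (ν (Iio (a - x))).toReal)) '' Icc 0 x)
  else 0

/-- Membership in the set `S₀`. -/
def memS0 (ν : Measure ℝ) (β : ℝ) (v : ℝ → ℝ) : Prop :=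
  (∀ x, 0 ≤ v x) ∧ (∀ x, 0 ≤ x → v x ≤ x + bbar ν β) ∧ (∀ x, x < 0 → v x = 0)
    ∧ MonotoneOn v (Ici 0) ∧ ContinuousOn v (Ici 0)

/-- Membership in the set `S`. -/
def memS (ν : Measure ℝ) (β : ℝ) (v : ℝ → ℝ) : Prop :=
  (∀ x, 0 ≤ v x) ∧ (∀ x, 0 ≤ x → x ≤ v x ∧ v x ≤ x + bbar ν β) ∧ (∀ x, x < 0 → v x = 0)
    ∧ MonotoneOn v (Ici 0) ∧ ContinuousOn v (Ici 0)

/-- A decision rule. -/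
def DecisionRule (α : ℝ → ℝ) : Prop :=
  Measurable α ∧ (∀ x, 0 ≤ x → α x ∈ Icc 0 x) ∧ (∀ x, x < 0 → α x = 0)

/-- The operator `L_α` associated with a decision rule `α`. -/
def Ldiv (ν : Measure ℝ) (β γ : ℝ) (α : ℝ → ℝ) (v : ℝ → ℝ) (x : ℝ) : ℝ :=
  if 0 ≤ x then
    α x - (β / γ) * Real.log
      ((∫ z in Ici (α x - x), Real.exp (-(γ * v (x - α x + z))) ∂ν)
        + (ν (Iio (α x - x))).toReal)
  else 0

/-- The function `Γ` associated with a value function `J`. -/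
def Gam (ν : Measure ℝ) (β γ : ℝ) (J : ℝ → ℝ) (x : ℝ) : ℝ :=
  -(β / γ) * Real.log
    ((∫ z in Ici (-x), Real.exp (-(γ * J (x + z))) ∂ν) + (ν (Iio (-x))).toReal)

end

/-- The function `z ↦ exp (-γ v (x - a + z))` is integrable, and its expectation is the argument
of the logarithm in `Tdiv`. -/
lemma setIntegral_add_measure_eq_integral (ν : Measure ℝ) [IsProbabilityMeasure ν] {γ : ℝ}
    {v : ℝ → ℝ} (hvm : Measurable v) (hγ : 0 ≤ γ) (hnn : ∀ x, 0 ≤ v x)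
    (hv0 : ∀ x : ℝ, x < 0 → v x = 0) (a x : ℝ) :
    Integrable (fun z => Real.exp (-(γ * v (x - a + z)))) ν ∧
    (∫ z in Ici (a - x), Real.exp (-(γ * v (x - a + z))) ∂ν) + (ν (Iio (a - x))).toReal
      = ∫ z, Real.exp (-(γ * v (x - a + z))) ∂ν := by
  have hI : Integrable (fun z => Real.exp (-(γ * v (x - a + z)))) ν := by
    refine Integrable.of_bound (C := 1) (Measurable.aestronglyMeasurable (by fun_prop))
      (ae_of_all _ fun z => ?_)
    rw [Real.norm_eq_abs, abs_of_pos (Real.exp_pos _), Real.exp_le_one_iff]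
    exact neg_nonpos.2 (mul_nonneg hγ (hnn _))
  refine ⟨hI, ?_⟩
  rw [← integral_add_compl (measurableSet_Ici (a := a - x)) hI, compl_Ici]
  congr 1
  have : ∫ z in Iio (a - x), Real.exp (-(γ * v (x - a + z))) ∂ν
      = ∫ z in Iio (a - x), (1 : ℝ) ∂ν := by
    refine setIntegral_congr_fun measurableSet_Iio fun z hz => ?_
    have hz : z < a - x := hz
    simp [hv0 (x - a + z) (by linarith)]
  rw [this]
  simp [Measure.real]

/-- The set whose supremum defines `Tdiv ν β γ v x` is bounded above. -/
lemma bddAbove_Tdiv_image (ν : Measure ℝ) [IsProbabilityMeasure ν] {β γ b : ℝ} {v : ℝ → ℝ}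
    (hvm : Measurable v) (hβ : 0 ≤ β) (hγ : 0 < γ) (hb : 0 ≤ b) (hnn : ∀ x, 0 ≤ v x)
    (hvb : ∀ x : ℝ, 0 ≤ x → v x ≤ x + b) (hv0 : ∀ x : ℝ, x < 0 → v x = 0) (x : ℝ) :
    BddAbove ((fun a => a - (β / γ) * Real.log
      ((∫ z in Ici (a - x), Real.exp (-(γ * v (x - a + z))) ∂ν)
        + (ν (Iio (a - x))).toReal)) '' Icc 0 x) := by
  have hI : Integrable (fun z => Real.exp (-(γ * (x + max z 0 + b)))) ν := by
    refine Integrable.of_bound (C := Real.exp (-(γ * (x + b)))) (by fun_prop)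
      (ae_of_all _ fun z => ?_)
    rw [Real.norm_eq_abs, abs_of_pos (Real.exp_pos _)]
    gcongr
    linarith [le_max_right z 0]
  have hpos : 0 < ∫ z, Real.exp (-(γ * (x + max z 0 + b))) ∂ν := integral_exp_pos hI
  refine ⟨x - (β / γ) * Real.log (∫ z, Real.exp (-(γ * (x + max z 0 + b))) ∂ν), ?_⟩
  rintro _ ⟨a, ⟨ha0, hax⟩, rfl⟩
  obtain ⟨hIv, heq⟩ := setIntegral_add_measure_eq_integral ν hvm hγ.le hnn hv0 a x
  dsimp only
  rw [heq]
  have hle : ∫ z, Real.exp (-(γ * (x + max z 0 + b))) ∂ν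
      ≤ ∫ z, Real.exp (-(γ * v (x - a + z))) ∂ν := by
    refine integral_mono hI hIv fun z => ?_
    dsimp only
    gcongr
    have h1 := le_max_left z 0
    have h2 := le_max_right z 0
    rcases lt_or_ge (x - a + z) 0 with h | h
    · rw [hv0 _ h]; linarith
    · linarith [hvb _ h]
  have hβγ : 0 ≤ β / γ := by positivity
  gcongr

/-- `Tdiv` is monotone and shifts upper bounds by at most the factor `β`. -/
lemma Tdiv_le_Tdiv_add (ν : Measure ℝ) [IsProbabilityMeasure ν] {β γ b M : ℝ} {u v : ℝ → ℝ}
    (hum : Measurable u) (hvm : Measurable v) (hβ : 0 ≤ β) (hγ : 0 < γ) (hb : 0 ≤ b)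
    (hM : 0 ≤ M) (hunn : ∀ x, 0 ≤ u x) (hvnn : ∀ x, 0 ≤ v x)
    (hvb : ∀ x : ℝ, 0 ≤ x → v x ≤ x + b)
    (hu0 : ∀ x : ℝ, x < 0 → u x = 0) (hv0 : ∀ x : ℝ, x < 0 → v x = 0)
    (h : ∀ x, u x ≤ v x + M) (x : ℝ) :
    Tdiv ν β γ u x ≤ Tdiv ν β γ v x + β * M := by
  unfold Tdiv
  split_ifs with hx
  swap
  · positivity
  refine csSup_le ((nonempty_Icc.2 hx).image _) ?_
  rintro _ ⟨a, ha, rfl⟩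
  refine le_trans ?_ (add_le_add_left
    (le_csSup (bddAbove_Tdiv_image ν hvm hβ hγ hb hvnn hvb hv0 x) (mem_image_of_mem _ ha)) _)
  obtain ⟨hIu, hequ⟩ := setIntegral_add_measure_eq_integral ν hum hγ.le hunn hu0 a x
  obtain ⟨hIv, heqv⟩ := setIntegral_add_measure_eq_integral ν hvm hγ.le hvnn hv0 a x
  dsimp only
  rw [hequ, heqv]
  have hposv : 0 < ∫ z, Real.exp (-(γ * v (x - a + z))) ∂ν := integral_exp_pos hIv
  have hle : Real.exp (-(γ * M)) * ∫ z, Real.exp (-(γ * v (x - a + z))) ∂ν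
      ≤ ∫ z, Real.exp (-(γ * u (x - a + z))) ∂ν := by
    rw [← integral_const_mul]
    refine integral_mono (hIv.const_mul _) hIu fun z => ?_
    dsimp only
    rw [← Real.exp_add, Real.exp_le_exp]
    nlinarith [h (x - a + z)]
  have hlog := Real.log_le_log (by positivity) hle
  rw [Real.log_mul (Real.exp_ne_zero _) hposv.ne', Real.log_exp] at hlog
  have hβγ : 0 ≤ β / γ := by positivity
  have hmul := mul_le_mul_of_nonneg_left hlog hβγ
  have hcancel : β / γ * (γ * M) = β * M := by field_simp
  linarith [mul_add (β / γ) (-(γ * M)) (Real.log (∫ z, Real.exp (-(γ * v (x - a + z))) ∂ν)),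
    mul_neg (β / γ) (γ * M)]

/-- Membership in `memS` implies Borel measurability. -/
lemma memS.measurable {ν : Measure ℝ} {β : ℝ} {v : ℝ → ℝ} (h : memS ν β v) : Measurable v := by
  obtain ⟨-, -, hneg, -, hcont⟩ := h
  have : v = (Ici (0 : ℝ)).piecewise v (fun _ => 0) := by
    funext x
    by_cases hx : x ∈ Ici (0 : ℝ)
    · simp only [piecewise_eq_of_mem _ _ _ hx]
    · simp only [piecewise_eq_of_notMem _ _ _ hx, hneg x (not_le.1 hx)]
  rw [this]
  exact hcont.measurable_piecewise continuousOn_const measurableSet_Ici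

/-- if `ν` has a Lebesgue-a.e. continuous density `g`, then any
Borel measurable `v` with `x ≤ v(x) ≤ x + b̄` on `[0,∞)` and `v(x) = 0` for
`x < 0` satisfying `Tv = v` equals the unique fixed point `J` of `T` in `S`. -/
theorem fixed_point_unique_in_Sprime (ν : Measure ℝ) [IsProbabilityMeasure ν]
    (g : ℝ → ℝ) (hg0 : ∀ z, 0 ≤ g z)
    (hdens : ν = volume.withDensity (fun z => ENNReal.ofReal (g z)))
    (hgcont : ∀ᵐ z ∂volume, ContinuousAt g z)
    (hint : Integrable (fun z => max z 0) ν) (hneg : 0 < ν (Iio 0))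
    (β γ : ℝ) (hβ : β ∈ Ioo (0:ℝ) 1) (hγ : 0 < γ)
    (J : ℝ → ℝ) (hJ : memS ν β J) (hfix : Tdiv ν β γ J = J)
    (v : ℝ → ℝ) (hvm : Measurable v)
    (hvb : ∀ x : ℝ, 0 ≤ x → x ≤ v x ∧ v x ≤ x + bbar ν β)
    (hv0 : ∀ x : ℝ, x < 0 → v x = 0)
    (hvfix : Tdiv ν β γ v = v) :
    v = J := by
  obtain ⟨hβ0, hβ1⟩ := hβ
  have hJm := hJ.measurable
  obtain ⟨hJnn, hJb, hJ0, -, -⟩ := hJ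
  have hb : 0 ≤ bbar ν β :=
    div_nonneg (mul_nonneg hβ0.le (integral_nonneg fun z => le_max_right z 0)) (by linarith)
  have hvnn : ∀ x, 0 ≤ v x := fun x => by
    rcases lt_or_ge x 0 with h | h
    · rw [hv0 x h]
    · exact h.trans (hvb x h).1
  have key : ∀ n : ℕ, ∀ x, |v x - J x| ≤ β ^ n * bbar ν β := by
    intro n
    induction n with
    | zero =>
      intro x
      rw [pow_zero, one_mul, abs_le]
      rcases lt_or_ge x 0 with h | h
      · rw [hv0 x h, hJ0 x h]
        constructor <;> linarith
      · obtain ⟨h1, h2⟩ := hvb x h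
        obtain ⟨h3, h4⟩ := hJb x h
        constructor <;> linarith
    | succ n ih =>
      intro x
      have hM : 0 ≤ β ^ n * bbar ν β := by positivity
      have h1 := Tdiv_le_Tdiv_add ν hvm hJm hβ0.le hγ hb hM hvnn hJnn (fun x hx => (hJb x hx).2)
        hv0 hJ0 (fun x => by linarith [(abs_le.1 (ih x)).2]) x
      have h2 := Tdiv_le_Tdiv_add ν hJm hvm hβ0.le hγ hb hM hJnn hvnn (fun x hx => (hvb x hx).2)
        hJ0 hv0 (fun x => by linarith [(abs_le.1 (ih x)).1]) x
      rw [hvfix, hfix] at h1 h2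
      rw [pow_succ', mul_assoc, abs_le]
      constructor <;> linarith
  funext x
  have hlim : Tendsto (fun n : ℕ => β ^ n * bbar ν β) atTop (𝓝 0) := by
    simpa using (tendsto_pow_atTop_nhds_zero_of_lt_one hβ0.le hβ1).mul_const (bbar ν β)
  have h0 := ge_of_tendsto' hlim fun n => key n x
  exact sub_eq_zero.1 (abs_nonpos_iff.1 h0)
end

section
/- Let J₁(x) := x for x ≥ 0 and J₁(x) := 0 for x < 0. Then for every x ≥ 0 the function u ↦ −u − (β/γ)·ln( e^{−γu}·∫_{[−u,∞)} e^{−γz} ν(dz) + ν((−∞,−u)) ) is strictly decreasing on [0,∞), the supremum defining T J₁(x) is attained exactly at a = x, and T J₁(x) = x − (β/γ)·ln( ∫_ℝ e^{−γ·max(z,0)} ν(dz) ); i.e., for a two-period horizon it is optimal to pay out everything immediately and J₂(x) = x + β·ρ(Z⁺), where ρ(Z⁺) := −(1/γ)·ln ∫_ℝ e^{−γ·max(z,0)} ν(dz). -/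
open MeasureTheory Set Filter Topology

/-- The expectation of `exp (-γ * (u + Z)⁺)` for `Z` distributed according to `ν`. -/
noncomputable def posPartLaplace (ν : Measure ℝ) (γ u : ℝ) : ℝ :=
  ∫ z, Real.exp (-(γ * max (u + z) 0)) ∂ν

theorem integrable_exp_neg_mul_max (ν : Measure ℝ) [IsFiniteMeasure ν] {γ : ℝ} (hγ : 0 < γ)
    (u : ℝ) : Integrable (fun z => Real.exp (-(γ * max (u + z) 0))) ν := by
  refine Integrable.of_bound (C := 1) (by fun_prop) (Eventually.of_forall fun z => ?_)
  rw [Real.norm_eq_abs, abs_of_pos (Real.exp_pos _), Real.exp_le_one_iff, neg_nonpos]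
  positivity

theorem posPartLaplace_pos (ν : Measure ℝ) [IsProbabilityMeasure ν] {γ : ℝ} (hγ : 0 < γ)
    (u : ℝ) : 0 < posPartLaplace ν γ u :=
  integral_exp_pos (integrable_exp_neg_mul_max ν hγ u)

theorem setIntegral_Ici_add_eq_posPartLaplace (ν : Measure ℝ) [IsFiniteMeasure ν] {γ : ℝ}
    (hγ : 0 < γ) {u c : ℝ} (hc : c = -u) {g : ℝ → ℝ}
    (hg : ∀ z, 0 ≤ u + z → g z = Real.exp (-(γ * (u + z)))) :
    (∫ z in Ici c, g z ∂ν) + (ν (Iio c)).toReal = posPartLaplace ν γ u := by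
  subst hc
  rw [posPartLaplace,
    ← integral_add_compl measurableSet_Ici (integrable_exp_neg_mul_max ν hγ u), compl_Ici]
  congr 1
  · refine setIntegral_congr_fun measurableSet_Ici fun z hz => ?_
    have h : 0 ≤ u + z := by linarith [mem_Ici.1 hz]
    simp only [hg z h, max_eq_left h]
  · have h : ∀ z ∈ Iio (-u), Real.exp (-(γ * max (u + z) 0)) = 1 := fun z hz => by
      rw [max_eq_right (by linarith [mem_Iio.1 hz])]
      simp
    rw [setIntegral_congr_fun measurableSet_Iio h]
    simp [Measure.real]

theorem log_posPartLaplace_le (ν : Measure ℝ) [IsProbabilityMeasure ν] {γ : ℝ} (hγ : 0 < γ)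
    {u w : ℝ} (huw : u ≤ w) :
    Real.log (posPartLaplace ν γ u) - γ * (w - u) ≤ Real.log (posPartLaplace ν γ w) := by
  have h : Real.exp (-(γ * (w - u))) * posPartLaplace ν γ u ≤ posPartLaplace ν γ w := by
    rw [posPartLaplace, posPartLaplace, ← integral_const_mul]
    refine integral_mono ((integrable_exp_neg_mul_max ν hγ u).const_mul _)
      (integrable_exp_neg_mul_max ν hγ w) fun z => ?_
    simp only [← Real.exp_add]
    refine Real.exp_le_exp.2 ?_
    have hmax : max (w + z) 0 ≤ (w - u) + max (u + z) 0 :=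
      max_le (by linarith [le_max_left (u + z) 0]) (by linarith [le_max_right (u + z) 0])
    nlinarith [mul_le_mul_of_nonneg_left hmax hγ.le]
  have hp := posPartLaplace_pos ν hγ u
  have := Real.log_le_log (by positivity) h
  rw [Real.log_mul (Real.exp_pos _).ne' hp.ne', Real.log_exp] at this
  linarith

theorem strictAnti_neg_sub_log_posPartLaplace (ν : Measure ℝ) [IsProbabilityMeasure ν]
    {β γ : ℝ} (hβ : β ∈ Ioo (0 : ℝ) 1) (hγ : 0 < γ) :
    StrictAnti fun u : ℝ => -u - (β / γ) * Real.log (posPartLaplace ν γ u) := by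
  intro u w huw
  have h := mul_le_mul_of_nonneg_left (log_posPartLaplace_le ν hγ huw.le)
    (div_nonneg hβ.1.le hγ.le)
  have hcancel : β / γ * (γ * (w - u)) = β * (w - u) := by field_simp
  rw [mul_sub, hcancel] at h
  have : β * (w - u) < w - u := mul_lt_of_lt_one_left (sub_pos.2 huw) hβ.2
  simp only
  linarith

/-- with `J₁(x) = x` for `x ≥ 0` and `J₁(x) = 0` for `x < 0`,
the transformed objective is strictly decreasing on `[0,∞)`, the supremum
defining `T J₁(x)` is attained exactly at `a = x`, and
`T J₁(x) = x + β ρ(Z⁺)` with `ρ(Z⁺) = -(1/γ) ln ∫ e^{-γ max(z,0)} ν(dz)`. -/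
theorem two_period_horizon (ν : Measure ℝ) [IsProbabilityMeasure ν]
    (hac : ν ≪ volume) (hint : Integrable (fun z => max z 0) ν)
    (hneg : 0 < ν (Iio 0)) (β γ : ℝ) (hβ : β ∈ Ioo (0:ℝ) 1) (hγ : 0 < γ) :
    StrictAntiOn (fun u : ℝ => -u - (β / γ) * Real.log
      (Real.exp (-(γ * u)) * (∫ z in Ici (-u), Real.exp (-(γ * z)) ∂ν)
        + (ν (Iio (-u))).toReal)) (Ici 0) ∧
    (∀ x : ℝ, 0 ≤ x →
      (Tdiv ν β γ (fun y => if 0 ≤ y then y else 0) x =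
        x - (β / γ) * Real.log
          ((∫ z in Ici (0:ℝ),
              Real.exp (-(γ * (if 0 ≤ z then z else 0))) ∂ν)
            + (ν (Iio (0:ℝ))).toReal)) ∧
      (∀ a ∈ Ico (0:ℝ) x,
        a - (β / γ) * Real.log
          ((∫ z in Ici (a - x),
              Real.exp (-(γ * (if 0 ≤ x - a + z then x - a + z else 0))) ∂ν)
            + (ν (Iio (a - x))).toReal)
          < Tdiv ν β γ (fun y => if 0 ≤ y then y else 0) x)) ∧
    (∀ x : ℝ, 0 ≤ x →
      Tdiv ν β γ (fun y => if 0 ≤ y then y else 0) x =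
        x + β * (-(1 / γ) * Real.log (∫ z, Real.exp (-(γ * max z 0)) ∂ν))) := by
  have hanti := strictAnti_neg_sub_log_posPartLaplace ν hβ hγ
  have hobj : ∀ x a : ℝ, (∫ z in Ici (a - x),
      Real.exp (-(γ * (if 0 ≤ x - a + z then x - a + z else 0))) ∂ν)
        + (ν (Iio (a - x))).toReal = posPartLaplace ν γ (x - a) := fun x a =>
    setIntegral_Ici_add_eq_posPartLaplace ν hγ (by ring) fun z hz => by rw [if_pos hz]
  have hT : ∀ x : ℝ, 0 ≤ x → Tdiv ν β γ (fun y => if 0 ≤ y then y else 0) x =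
      x - (β / γ) * Real.log (posPartLaplace ν γ 0) := fun x hx => by
    simp only [Tdiv, if_pos hx, hobj]
    refine IsGreatest.csSup_eq ⟨⟨x, ⟨hx, le_rfl⟩, by simp⟩, ?_⟩
    rintro _ ⟨a, ha, rfl⟩
    have := hanti.antitone (sub_nonneg.2 ha.2)
    simp only at this ⊢
    linarith
  refine ⟨?_, fun x hx => ⟨?_, fun a ha => ?_⟩, fun x hx => ?_⟩
  · convert hanti.strictAntiOn (Ici 0) using 5 with u
    rw [← integral_const_mul]
    refine setIntegral_Ici_add_eq_posPartLaplace ν hγ rfl fun z _ => ?_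
    rw [← Real.exp_add]
    ring_nf
  · rw [hT x hx, setIntegral_Ici_add_eq_posPartLaplace ν hγ (u := 0) neg_zero.symm]
    intro z hz
    rw [zero_add] at hz ⊢
    rw [if_pos hz]
  · rw [hobj, hT x hx]
    have := hanti (sub_pos.2 ha.2)
    simp only at this
    linarith
  · rw [hT x hx]
    simp only [posPartLaplace, zero_add]
    ring
end

section
/- Suppose ν has the left-sided exponential density g(z) = λ·e^{λ(z−d)} for z ≤ d and g(z) = 0 for z > d, where λ > 0 and λd > 1. If γ ≥ βλ, then for every x ≥ 0 the map u ↦ −u − (β/γ)·ln( ∫_{[0,d+u]} e^{−γ J(y)} g(y−u) dy + G(−u) ) is strictly decreasing on [0,∞) (where G is the cumulative distribution function of ν), the supremum in the fixed point equation for J is attained at a = x, and consequently J(x) = x + J(0) for all x ≥ 0; i.e., the optimal policy pays out the entire reserve immediately. -/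
open MeasureTheory Set Filter Topology

noncomputable section

/-- The left-sided exponential density `g(z) = λ e^{λ(z-d)}` for `z ≤ d`. -/
def expDens (lam d z : ℝ) : ℝ := if z ≤ d then lam * Real.exp (lam * (z - d)) else 0

end

lemma expDens_nonneg {lam : ℝ} (hlam : 0 < lam) (d z : ℝ) : 0 ≤ expDens lam d z := by
  unfold expDens
  split_ifs <;> positivity

lemma measurable_expDens (lam d : ℝ) : Measurable (expDens lam d) :=
  Measurable.ite measurableSet_Iic (by fun_prop) measurable_const

lemma setIntegral_withDensity_expDens {lam : ℝ} (hlam : 0 < lam) (d : ℝ) (f : ℝ → ℝ)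
    {s : Set ℝ} (hs : MeasurableSet s) :
    ∫ z in s, f z ∂volume.withDensity (fun z => ENNReal.ofReal (expDens lam d z))
      = ∫ z in s, f z * expDens lam d z := by
  rw [setIntegral_withDensity_eq_setIntegral_toReal_smul
    (measurable_expDens lam d).ennreal_ofReal (by simp) _ hs]
  simp only [ENNReal.toReal_ofReal (expDens_nonneg hlam d _), smul_eq_mul, mul_comm]

lemma withDensity_expDens_Iio {lam : ℝ} (hlam : 0 < lam) {c d : ℝ} (hc : c ≤ d) :
    (volume.withDensity (fun z => ENNReal.ofReal (expDens lam d z)) (Iio c)).toReal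
      = Real.exp (lam * (c - d)) := by
  have h := setIntegral_withDensity_expDens hlam d (fun _ => 1) (measurableSet_Iio (a := c))
  rw [setIntegral_one_eq_measureReal] at h
  rw [← measureReal_def, h]
  have hcongr : ∀ z ∈ Iio c, 1 * expDens lam d z
      = lam * Real.exp (-(lam * d)) * Real.exp (lam * z) := fun z hz => by
    rw [expDens, if_pos (hz.le.trans hc), one_mul, mul_assoc, ← Real.exp_add]
    ring_nf
  rw [setIntegral_congr_fun measurableSet_Iio hcongr, integral_const_mul,
    ← integral_Iic_eq_integral_Iio, integral_exp_mul_Iic hlam]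
  field_simp
  rw [← Real.exp_add]
  ring_nf

/-- The change of variables `y = u + z` for an integral against the left-sided exponential law. -/
lemma setIntegral_Ici_withDensity_expDens {lam : ℝ} (hlam : 0 < lam) (d u : ℝ) (f : ℝ → ℝ) :
    ∫ z in Ici (-u), f (u + z) ∂volume.withDensity (fun z => ENNReal.ofReal (expDens lam d z))
      = ∫ y in Icc 0 (d + u), f y * expDens lam d (y - u) := by
  rw [setIntegral_withDensity_expDens hlam d _ measurableSet_Ici,
    ← integral_indicator measurableSet_Ici, ← integral_indicator measurableSet_Icc,
    ← integral_sub_right_eq_self _ u]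
  congr 1
  ext y
  by_cases h0 : 0 ≤ y
  · by_cases h1 : y ≤ d + u
    · rw [indicator_of_mem (by simpa using h0), indicator_of_mem (mem_Icc.2 ⟨h0, h1⟩),
        add_sub_cancel]
    · rw [indicator_of_mem (by simpa using h0),
        indicator_of_notMem (fun h : y ∈ Icc 0 (d + u) => h1 h.2), expDens, if_neg (by linarith), mul_zero]
  · rw [indicator_of_notMem (by simpa using h0),
      indicator_of_notMem (fun h : y ∈ Icc 0 (d + u) => h0 h.1)]

lemma setIntegral_Icc_mul_expDens (lam d γ : ℝ) {u : ℝ} (hdu : 0 ≤ d + u) (J : ℝ → ℝ) :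
    ∫ y in Icc (0:ℝ) (d + u), Real.exp (-(γ * J y)) * expDens lam d (y - u)
      = Real.exp (-(lam * (d + u))) *
        (lam * ∫ y in (0:ℝ)..(d + u), Real.exp (lam * y - γ * J y)) := by
  rw [intervalIntegral.integral_of_le hdu, ← integral_Icc_eq_integral_Ioc, ← mul_assoc,
    ← integral_const_mul]
  refine setIntegral_congr_fun measurableSet_Icc fun y hy => ?_
  have hy' : y - u ≤ d := by linarith [hy.2]
  simp only [expDens, if_pos hy']
  rw [mul_left_comm, ← Real.exp_add, mul_comm (Real.exp (-(lam * (d + u)))), mul_assoc,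
    ← Real.exp_add]
  ring_nf

lemma intervalIntegrable_exp_sub {J : ℝ → ℝ} (hJ : ContinuousOn J (Ici 0)) (lam γ : ℝ)
    {a b : ℝ} (ha : 0 ≤ a) (hb : 0 ≤ b) :
    IntervalIntegrable (fun y => Real.exp (lam * y - γ * J y)) volume a b := by
  refine ContinuousOn.intervalIntegrable ?_
  have : ContinuousOn J (uIcc a b) := hJ.mono fun y hy => (le_min ha hb).trans hy.1
  fun_prop

lemma strictMonoOn_one_add_mul_integral {J : ℝ → ℝ} (hJ : ContinuousOn J (Ici 0)) {lam : ℝ}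
    (hlam : 0 < lam) (γ : ℝ) :
    StrictMonoOn (fun s => 1 + lam * ∫ y in (0:ℝ)..s, Real.exp (lam * y - γ * J y)) (Ici 0) := by
  intro s hs t ht hst
  have hpos : 0 < ∫ y in s..t, Real.exp (lam * y - γ * J y) :=
    intervalIntegral.intervalIntegral_pos_of_pos (intervalIntegrable_exp_sub hJ lam γ hs ht)
      (fun _ => Real.exp_pos _) hst
  have hadd := intervalIntegral.integral_add_adjacent_intervals
    (intervalIntegrable_exp_sub hJ lam γ le_rfl hs) (intervalIntegrable_exp_sub hJ lam γ hs ht)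
  simp only
  rw [← hadd]
  linarith [mul_pos hlam hpos]

lemma strictAntiOn_neg_sub_log_expDens {lam d β γ : ℝ} (hlam : 0 < lam) (hd : 0 < d)
    (hβ : 0 < β) (hγ : 0 < γ) (hγlam : β * lam ≤ γ) {J : ℝ → ℝ}
    (hJ : ContinuousOn J (Ici 0)) :
    StrictAntiOn (fun u : ℝ => -u - (β / γ) * Real.log
      ((∫ y in Icc (0:ℝ) (d + u), Real.exp (-(γ * J y)) * expDens lam d (y - u))
        + (volume.withDensity (fun z => ENNReal.ofReal (expDens lam d z)) (Iio (-u))).toReal))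
      (Ici 0) := by
  have hmono := strictMonoOn_one_add_mul_integral hJ hlam γ
  set F : ℝ → ℝ := fun s => 1 + lam * ∫ y in (0:ℝ)..s, Real.exp (lam * y - γ * J y) with hF
  have hFpos : ∀ s, 0 ≤ s → 0 < F s := fun s hs => by
    have h0 : F 0 = 1 := by simp [hF]
    have := hmono.monotoneOn self_mem_Ici hs hs
    linarith
  have hrepr : EqOn (fun u => -u * (1 - β / γ * lam) + β / γ * lam * d
        - β / γ * Real.log (F (d + u)))
      (fun u : ℝ => -u - (β / γ) * Real.log
        ((∫ y in Icc (0:ℝ) (d + u), Real.exp (-(γ * J y)) * expDens lam d (y - u))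
          + (volume.withDensity (fun z => ENNReal.ofReal (expDens lam d z)) (Iio (-u))).toReal))
      (Ici 0) := by
    intro u hu
    have hu' : (0:ℝ) ≤ u := hu
    have hdu : 0 ≤ d + u := by linarith
    have hexp : lam * (-u - d) = -(lam * (d + u)) := by ring
    simp only
    rw [setIntegral_Icc_mul_expDens lam d γ hdu, withDensity_expDens_Iio hlam (by linarith),
      hexp, ← mul_add_one, add_comm _ (1:ℝ), Real.log_mul (Real.exp_pos _).ne' (hFpos _ hdu).ne',
      Real.log_exp]
    ring
  refine StrictAntiOn.congr ?_ hrepr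
  intro u hu v hv huv
  have hu' : (0:ℝ) ≤ u := hu
  have hv' : (0:ℝ) ≤ v := hv
  have hlog : Real.log (F (d + u)) < Real.log (F (d + v)) :=
    Real.log_lt_log (hFpos _ (by linarith))
      (hmono (mem_Ici.2 (by linarith)) (mem_Ici.2 (by linarith)) (by linarith))
  have hc : 0 ≤ 1 - β / γ * lam := by
    rw [sub_nonneg, div_mul_eq_mul_div, div_le_one hγ]
    exact hγlam
  have h1 := mul_le_mul_of_nonneg_right huv.le hc
  have h2 := mul_lt_mul_of_pos_left hlog (div_pos hβ hγ)
  simp only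
  linarith

/-- for the left-sided exponential density with `λ > 0`, `λd > 1`,
if `γ ≥ βλ` then the transformed objective is strictly decreasing on `[0,∞)`,
the supremum in the fixed point equation is attained at `a = x`, and
`J(x) = x + J(0)` for all `x ≥ 0`: the optimal policy pays out everything. -/
theorem left_exponential_pay_all (ν : Measure ℝ) [IsProbabilityMeasure ν]
    (lam d : ℝ) (hlam : 0 < lam) (hld : 1 < lam * d)
    (hν : ν = volume.withDensity (fun z => ENNReal.ofReal (expDens lam d z)))
    (β γ : ℝ) (hβ : β ∈ Ioo (0:ℝ) 1) (hγ : 0 < γ) (hγlam : β * lam ≤ γ)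
    (J : ℝ → ℝ) (hJ : memS ν β J) (hfix : Tdiv ν β γ J = J) :
    StrictAntiOn (fun u : ℝ => -u - (β / γ) * Real.log
      ((∫ y in Icc (0:ℝ) (d + u), Real.exp (-(γ * J y)) * expDens lam d (y - u))
        + (ν (Iio (-u))).toReal)) (Ici 0) ∧
    (∀ x : ℝ, 0 ≤ x →
      J x = x - (β / γ) * Real.log
        ((∫ z in Ici (0:ℝ), Real.exp (-(γ * J z)) ∂ν) + (ν (Iio (0:ℝ))).toReal)) ∧
    (∀ x : ℝ, 0 ≤ x → J x = x + J 0) := by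
  have hd : 0 < d := pos_of_mul_pos_right (by linarith) hlam.le
  have hanti : StrictAntiOn (fun u : ℝ => -u - (β / γ) * Real.log
      ((∫ y in Icc (0:ℝ) (d + u), Real.exp (-(γ * J y)) * expDens lam d (y - u))
        + (ν (Iio (-u))).toReal)) (Ici 0) := by
    rw [hν]
    exact strictAntiOn_neg_sub_log_expDens hlam hd hβ.1 hγ hγlam hJ.2.2.2.2
  have hshift (u : ℝ) : ∫ z in Ici (-u), Real.exp (-(γ * J (u + z))) ∂ν
      = ∫ y in Icc (0:ℝ) (d + u), Real.exp (-(γ * J y)) * expDens lam d (y - u) := by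
    rw [hν]
    exact setIntegral_Ici_withDensity_expDens hlam d u fun y => Real.exp (-(γ * J y))
  have hpay (x : ℝ) (hx : 0 ≤ x) : J x = x - (β / γ) * Real.log
      ((∫ z in Ici (0:ℝ), Real.exp (-(γ * J z)) ∂ν) + (ν (Iio (0:ℝ))).toReal) := by
    have hgreatest : IsGreatest ((fun a => a - (β / γ) * Real.log
        ((∫ z in Ici (a - x), Real.exp (-(γ * J (x - a + z))) ∂ν)
          + (ν (Iio (a - x))).toReal)) '' Icc 0 x)
        (x - (β / γ) * Real.log
          ((∫ z in Ici (0:ℝ), Real.exp (-(γ * J z)) ∂ν) + (ν (Iio (0:ℝ))).toReal)) := by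
      refine ⟨⟨x, right_mem_Icc.2 hx, by simp⟩, ?_⟩
      rintro _ ⟨a, ha, rfl⟩
      have hle := hanti.antitoneOn self_mem_Ici (mem_Ici.2 (sub_nonneg.2 ha.2))
        (sub_nonneg.2 ha.2)
      simp only [← hshift, neg_sub, neg_zero, zero_add] at hle
      simp only
      linarith
    rw [← congrFun hfix x, Tdiv, if_pos hx, hgreatest.csSup_eq]
  refine ⟨hanti, hpay, fun x hx => ?_⟩
  rw [hpay x hx, hpay 0 le_rfl]
  ring
end
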